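/- Let b, c ≥ 0 be real numbers with b + c ≥ 2/3, and let v ∈ ℂ³ ⊗ ℂ³ be a unit vector. If 2b + c ≥ 3 or b + 2c ≥ 3, then every eigenvalue of (id_3 ⊗ Φ_{b,c}†)(v v†) is at most max{b, c}/2. Otherwise (i.e., if 2b + c < 3 and b + 2c < 3), every eigenvalue of (id_3 ⊗ Φ_{b,c}†)(v v†) is at most (b² + c² − 6(b+c) + bc + 9)/(6(2 − b − c)). -/

import Mathlib

open Matrix BigOperators
open scoped ComplexOrder

noncomputable section

/-- The generalized Choi map `Φ_{b,c} : M₃(ℂ) → M₃(ℂ)` (with `a = 2 - b - c`). -/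
def PhiG (b c : ℝ) (X : Matrix (Fin 3) (Fin 3) ℂ) : Matrix (Fin 3) (Fin 3) ℂ :=
  (1 / 2 : ℂ) •
    !![((2 - b - c : ℝ) : ℂ) * X 0 0 + (b : ℂ) * X 1 1 + (c : ℂ) * X 2 2,
         -(X 0 1), -(X 0 2);
       -(X 1 0),
         (c : ℂ) * X 0 0 + ((2 - b - c : ℝ) : ℂ) * X 1 1 + (b : ℂ) * X 2 2,
         -(X 1 2);
       -(X 2 0), -(X 2 1),
         (b : ℂ) * X 0 0 + (c : ℂ) * X 1 1 + ((2 - b - c : ℝ) : ℂ) * X 2 2]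

/-- The map `id_n ⊗ Φ`, acting blockwise on an `n² × n²` matrix indexed by
`Fin n × Fin n`. -/
def idTensor {n : ℕ} (Φ : Matrix (Fin n) (Fin n) ℂ → Matrix (Fin n) (Fin n) ℂ)
    (X : Matrix (Fin n × Fin n) (Fin n × Fin n) ℂ) :
    Matrix (Fin n × Fin n) (Fin n × Fin n) ℂ :=
  Matrix.of fun p q => Φ (Matrix.of fun k l => X (p.1, k) (q.1, l)) p.2 q.2

/-- Weighted Cauchy–Schwarz inequality with weights `1`, `p₁² / m₁`, `p₂² / m₂`, cleared of
denominators. -/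
lemma mul_sq_add_le_weighted (S p₁ p₂ r₁ r₂ m₁ m₂ : ℝ) (h₁ : 0 ≤ m₁) (h₂ : 0 ≤ m₂) :
    m₁ * m₂ * (S + p₁ * r₁ + p₂ * r₂) ^ 2 ≤
      (m₁ * m₂ + p₁ ^ 2 * m₂ + p₂ ^ 2 * m₁) * (S ^ 2 + m₁ * r₁ ^ 2 + m₂ * r₂ ^ 2) := by
  have e₁ := mul_nonneg h₂ (sq_nonneg (m₁ * r₁ - p₁ * S))
  have e₂ := mul_nonneg h₁ (sq_nonneg (m₂ * r₂ - p₂ * S))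
  have e₃ := sq_nonneg (p₁ * m₂ * r₂ - p₂ * m₁ * r₁)
  linarith

/-- Nonnegativity of the quadratic form `∑ mₖ rₖ² + S²` when only the weight
`m₀ = -α p₀² + β p₁² + γ p₂²` is negative. -/
lemma weighted_form_nonneg_of_neg (α β γ p₀ p₁ p₂ r₀ r₁ r₂ S : ℝ)
    (hα : 0 < α) (hα1 : α ≤ 1) (hβ : 0 < β) (hγ : 0 < γ) (hαβγ : α ^ 2 = β * γ)
    (hp₀ : 0 ≤ p₀) (hr₀ : 0 ≤ r₀)
    (ht : p₀ * r₀ ≤ S + p₁ * r₁ + p₂ * r₂)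
    (hneg : -α * p₀ ^ 2 + β * p₁ ^ 2 + γ * p₂ ^ 2 < 0) :
    0 ≤ (-α * p₀ ^ 2 + β * p₁ ^ 2 + γ * p₂ ^ 2) * r₀ ^ 2
      + (γ * p₀ ^ 2 - α * p₁ ^ 2 + β * p₂ ^ 2) * r₁ ^ 2
      + (β * p₀ ^ 2 + γ * p₁ ^ 2 - α * p₂ ^ 2) * r₂ ^ 2 + S ^ 2 := by
  obtain ⟨e, he⟩ : ∃ e, e = α * p₀ ^ 2 - β * p₁ ^ 2 - γ * p₂ ^ 2 := ⟨_, rfl⟩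
  obtain ⟨m₁, hm₁⟩ : ∃ m, m = γ * p₀ ^ 2 - α * p₁ ^ 2 + β * p₂ ^ 2 := ⟨_, rfl⟩
  obtain ⟨m₂, hm₂⟩ : ∃ m, m = β * p₀ ^ 2 + γ * p₁ ^ 2 - α * p₂ ^ 2 := ⟨_, rfl⟩
  rw [show -α * p₀ ^ 2 + β * p₁ ^ 2 + γ * p₂ ^ 2 = -e by rw [he]; ring, ← hm₁, ← hm₂]
  have he0 : 0 < e := by rw [he]; linarith
  have g₁ : γ * e ≤ α * m₁ := by
    have : α * m₁ = γ * e + (γ ^ 2 + α * β) * p₂ ^ 2 := by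
      rw [he, hm₁]; linear_combination (-p₁ ^ 2) * hαβγ
    rw [this]
    have : 0 ≤ (γ ^ 2 + α * β) * p₂ ^ 2 := by positivity
    linarith
  have g₂ : β * e ≤ α * m₂ := by
    have : α * m₂ = β * e + (β ^ 2 + α * γ) * p₁ ^ 2 := by
      rw [he, hm₂]; linear_combination (-p₂ ^ 2) * hαβγ
    rw [this]
    have : 0 ≤ (β ^ 2 + α * γ) * p₁ ^ 2 := by positivity
    linarith
  have m₁pos : 0 < m₁ := pos_of_mul_pos_right (lt_of_lt_of_le (by positivity) g₁) hα.le
  have m₂pos : 0 < m₂ := pos_of_mul_pos_right (lt_of_lt_of_le (by positivity) g₂) hα.le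
  have f₁ : α * e ≤ β * m₁ := by
    refine le_of_mul_le_mul_left ?_ hα
    calc α * (α * e) = β * (γ * e) := by linear_combination e * hαβγ
      _ ≤ β * (α * m₁) := by gcongr
      _ = _ := by ring
  have f₂ : α * e ≤ γ * m₂ := by
    refine le_of_mul_le_mul_left ?_ hα
    calc α * (α * e) = γ * (β * e) := by linear_combination e * hαβγ
      _ ≤ γ * (α * m₂) := by gcongr
      _ = _ := by ring
  have key : e * (m₁ * m₂ + p₁ ^ 2 * m₂ + p₂ ^ 2 * m₁) ≤ p₀ ^ 2 * (m₁ * m₂) := by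
    refine le_of_mul_le_mul_left ?_ hα
    have k₁ : 0 ≤ (p₁ ^ 2 * m₂) * (β * m₁ - α * e) :=
      mul_nonneg (by positivity) (by linarith)
    have k₂ : 0 ≤ (p₂ ^ 2 * m₁) * (γ * m₂ - α * e) :=
      mul_nonneg (by positivity) (by linarith)
    have k₃ : 0 ≤ (1 - α) * (e * (m₁ * m₂)) := mul_nonneg (by linarith) (by positivity)
    have k₄ : α * p₀ ^ 2 * (m₁ * m₂) = (e + β * p₁ ^ 2 + γ * p₂ ^ 2) * (m₁ * m₂) := by
      rw [he]; ring
    linarith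
  have hp₀pos : 0 < p₀ ^ 2 := by
    refine pos_of_mul_pos_right (b := p₀ ^ 2) (a := α) ?_ hα.le
    nlinarith [mul_nonneg hβ.le (sq_nonneg p₁), mul_nonneg hγ.le (sq_nonneg p₂)]
  have hB : 0 ≤ S ^ 2 + m₁ * r₁ ^ 2 + m₂ * r₂ ^ 2 := by positivity
  have cs := mul_sq_add_le_weighted S p₁ p₂ r₁ r₂ m₁ m₂ m₁pos.le m₂pos.le
  have hsq : (p₀ * r₀) ^ 2 ≤ (S + p₁ * r₁ + p₂ * r₂) ^ 2 :=
    pow_le_pow_left₀ (by positivity) ht 2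
  have fin : (p₀ ^ 2 * (m₁ * m₂)) * (e * r₀ ^ 2) ≤
      (p₀ ^ 2 * (m₁ * m₂)) * (S ^ 2 + m₁ * r₁ ^ 2 + m₂ * r₂ ^ 2) := by
    calc (p₀ ^ 2 * (m₁ * m₂)) * (e * r₀ ^ 2) = e * (m₁ * m₂ * (p₀ * r₀) ^ 2) := by ring
      _ ≤ e * (m₁ * m₂ * (S + p₁ * r₁ + p₂ * r₂) ^ 2) := by gcongr
      _ ≤ e * ((m₁ * m₂ + p₁ ^ 2 * m₂ + p₂ ^ 2 * m₁) *
            (S ^ 2 + m₁ * r₁ ^ 2 + m₂ * r₂ ^ 2)) := by gcongr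
      _ = (e * (m₁ * m₂ + p₁ ^ 2 * m₂ + p₂ ^ 2 * m₁)) *
            (S ^ 2 + m₁ * r₁ ^ 2 + m₂ * r₂ ^ 2) := by ring
      _ ≤ _ := by gcongr
  have := le_of_mul_le_mul_left fin (by positivity)
  linarith

/-- Nonnegativity of the circulant-weighted form `∑ mₖ rₖ² + S²`, where `S` satisfies the
triangle inequalities of the modulus of a sum of complex numbers of moduli `pₖ rₖ`. -/
lemma weighted_form_nonneg (α β γ p₀ p₁ p₂ r₀ r₁ r₂ S : ℝ)
    (hα : 0 < α) (hα1 : α ≤ 1) (hβ : 0 < β) (hγ : 0 < γ) (hαβγ : α ^ 2 = β * γ)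
    (hp₀ : 0 ≤ p₀) (hp₁ : 0 ≤ p₁) (hp₂ : 0 ≤ p₂) (hr₀ : 0 ≤ r₀) (hr₁ : 0 ≤ r₁) (hr₂ : 0 ≤ r₂)
    (ht₀ : p₀ * r₀ ≤ S + p₁ * r₁ + p₂ * r₂)
    (ht₁ : p₁ * r₁ ≤ S + p₂ * r₂ + p₀ * r₀)
    (ht₂ : p₂ * r₂ ≤ S + p₀ * r₀ + p₁ * r₁) :
    0 ≤ (-α * p₀ ^ 2 + β * p₁ ^ 2 + γ * p₂ ^ 2) * r₀ ^ 2
      + (γ * p₀ ^ 2 - α * p₁ ^ 2 + β * p₂ ^ 2) * r₁ ^ 2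
      + (β * p₀ ^ 2 + γ * p₁ ^ 2 - α * p₂ ^ 2) * r₂ ^ 2 + S ^ 2 := by
  by_cases h₀ : -α * p₀ ^ 2 + β * p₁ ^ 2 + γ * p₂ ^ 2 < 0
  · exact weighted_form_nonneg_of_neg α β γ p₀ p₁ p₂ r₀ r₁ r₂ S hα hα1 hβ hγ hαβγ hp₀ hr₀ ht₀ h₀
  by_cases h₁ : -α * p₁ ^ 2 + β * p₂ ^ 2 + γ * p₀ ^ 2 < 0
  · have := weighted_form_nonneg_of_neg α β γ p₁ p₂ p₀ r₁ r₂ r₀ S hα hα1 hβ hγ hαβγ hp₁ hr₁ ht₁ h₁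
    linarith
  by_cases h₂ : -α * p₂ ^ 2 + β * p₀ ^ 2 + γ * p₁ ^ 2 < 0
  · have := weighted_form_nonneg_of_neg α β γ p₂ p₀ p₁ r₂ r₀ r₁ S hα hα1 hβ hγ hαβγ hp₂ hr₂ ht₂ h₂
    linarith
  have n₀ : 0 ≤ -α * p₀ ^ 2 + β * p₁ ^ 2 + γ * p₂ ^ 2 := by linarith
  have n₁ : 0 ≤ γ * p₀ ^ 2 - α * p₁ ^ 2 + β * p₂ ^ 2 := by linarith
  have n₂ : 0 ≤ β * p₀ ^ 2 + γ * p₁ ^ 2 - α * p₂ ^ 2 := by linarith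
  positivity

lemma exists_sq_le_of_sq_le_mul {P Q s : ℝ} (hP : 0 ≤ P) (hQ : 0 ≤ Q) (hs : 0 ≤ s)
    (h : s ^ 2 ≤ P * Q) : ∃ r, 0 ≤ r ∧ r ^ 2 ≤ Q ∧ s = √P * r := by
  rcases hP.eq_or_lt with rfl | hP
  · refine ⟨0, le_rfl, by simpa using hQ, ?_⟩
    have : s ^ 2 ≤ 0 := by simpa using h
    simpa using pow_eq_zero_iff two_ne_zero |>.mp (le_antisymm this (sq_nonneg s))
  · refine ⟨s / √P, by positivity, ?_, by field_simp⟩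
    rw [div_pow, Real.sq_sqrt hP.le, div_le_iff₀ hP]
    linarith

/-- The scalar inequality behind the bound: `P`, `Q` are squared norms of the slices of two
vectors, and `t` collects the overlaps of matching slices. -/
lemma choi_scalar_bound (A b c μ P₀ P₁ P₂ Q₀ Q₁ Q₂ : ℝ) (t₀ t₁ t₂ : ℂ)
    (hA : μ < A) (hA1 : A - μ ≤ 1) (hc : 0 ≤ c) (hβ : c < μ) (hγ : b < μ)
    (hμ : (A - μ) ^ 2 = (μ - c) * (μ - b))
    (hP₀ : 0 ≤ P₀) (hP₁ : 0 ≤ P₁) (hP₂ : 0 ≤ P₂) (hQ₀ : 0 ≤ Q₀) (hQ₁ : 0 ≤ Q₁) (hQ₂ : 0 ≤ Q₂)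
    (ht₀ : ‖t₀‖ ^ 2 ≤ P₀ * Q₀) (ht₁ : ‖t₁‖ ^ 2 ≤ P₁ * Q₁) (ht₂ : ‖t₂‖ ^ 2 ≤ P₂ * Q₂) :
    A * (‖t₀‖ ^ 2 + ‖t₁‖ ^ 2 + ‖t₂‖ ^ 2) + c * (P₁ * Q₀ + P₂ * Q₁ + P₀ * Q₂)
      + b * (P₂ * Q₀ + P₀ * Q₁ + P₁ * Q₂) - ‖t₀ + t₁ + t₂‖ ^ 2
      ≤ μ * ((P₀ + P₁ + P₂) * (Q₀ + Q₁ + Q₂)) := by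
  obtain ⟨r₀, hr₀, hrQ₀, hs₀⟩ := exists_sq_le_of_sq_le_mul hP₀ hQ₀ (norm_nonneg t₀) ht₀
  obtain ⟨r₁, hr₁, hrQ₁, hs₁⟩ := exists_sq_le_of_sq_le_mul hP₁ hQ₁ (norm_nonneg t₁) ht₁
  obtain ⟨r₂, hr₂, hrQ₂, hs₂⟩ := exists_sq_le_of_sq_le_mul hP₂ hQ₂ (norm_nonneg t₂) ht₂
  have tri : ∀ x y z : ℂ, ‖x‖ ≤ ‖x + y + z‖ + ‖y‖ + ‖z‖ := fun x y z => by
    calc ‖x‖ = ‖x + y + z - y - z‖ := by congr 1; ring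
      _ ≤ ‖x + y + z - y‖ + ‖z‖ := norm_sub_le _ _
      _ ≤ _ := by gcongr; exact norm_sub_le _ _
  have a₀ := tri t₀ t₁ t₂
  have a₁ := tri t₁ t₂ t₀
  have a₂ := tri t₂ t₀ t₁
  rw [show t₁ + t₂ + t₀ = t₀ + t₁ + t₂ by ring] at a₁
  rw [show t₂ + t₀ + t₁ = t₀ + t₁ + t₂ by ring] at a₂
  generalize ‖t₀ + t₁ + t₂‖ = S at *
  rw [hs₀, hs₁, hs₂] at a₀ a₁ a₂ ⊢
  have main := weighted_form_nonneg (A - μ) (μ - c) (μ - b) (√P₀) (√P₁) (√P₂) r₀ r₁ r₂ S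
    (by linarith) hA1 (by linarith) (by linarith) hμ (Real.sqrt_nonneg _) (Real.sqrt_nonneg _)
    (Real.sqrt_nonneg _) hr₀ hr₁ hr₂ a₀ a₁ a₂
  simp only [mul_pow, Real.sq_sqrt hP₀, Real.sq_sqrt hP₁, Real.sq_sqrt hP₂] at main ⊢
  have hμ0 : 0 ≤ μ := by linarith
  have n₀ : 0 ≤ (μ * P₀ + (μ - c) * P₁ + (μ - b) * P₂) * (Q₀ - r₀ ^ 2) :=
    mul_nonneg (by have := sub_pos.2 hβ; have := sub_pos.2 hγ; positivity) (by linarith)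
  have n₁ : 0 ≤ (μ * P₁ + (μ - c) * P₂ + (μ - b) * P₀) * (Q₁ - r₁ ^ 2) :=
    mul_nonneg (by have := sub_pos.2 hβ; have := sub_pos.2 hγ; positivity) (by linarith)
  have n₂ : 0 ≤ (μ * P₂ + (μ - c) * P₀ + (μ - b) * P₁) * (Q₂ - r₂ ^ 2) :=
    mul_nonneg (by have := sub_pos.2 hβ; have := sub_pos.2 hγ; positivity) (by linarith)
  linarith

/-- The overlap of the slices `v (·, m)` and `u (·, k)`. -/
def sliceOverlap (v u : Fin 3 × Fin 3 → ℂ) (m k : Fin 3) : ℂ := ∑ i, star (v (i, m)) * u (i, k)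

/-- The squared norm of the slice `v (·, k)`. -/
def sliceNormSq (v : Fin 3 × Fin 3 → ℂ) (k : Fin 3) : ℝ := ∑ i, ‖v (i, k)‖ ^ 2

lemma sliceNormSq_nonneg (v : Fin 3 × Fin 3 → ℂ) (k : Fin 3) : 0 ≤ sliceNormSq v k :=
  Finset.sum_nonneg fun _ _ => sq_nonneg _

lemma norm_sliceOverlap_sq_le (v u : Fin 3 × Fin 3 → ℂ) (m k : Fin 3) :
    ‖sliceOverlap v u m k‖ ^ 2 ≤ sliceNormSq v m * sliceNormSq u k := by
  calc ‖sliceOverlap v u m k‖ ^ 2 ≤ (∑ i, ‖v (i, m)‖ * ‖u (i, k)‖) ^ 2 := by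
        gcongr
        refine (norm_sum_le _ _).trans_eq ?_
        simp
    _ ≤ _ := Finset.sum_mul_sq_le_sq_mul_sq _ _ _

lemma sliceNormSq_sum (v : Fin 3 × Fin 3 → ℂ) (hv : ∑ p, ‖v p‖ ^ 2 = 1) :
    sliceNormSq v 0 + sliceNormSq v 1 + sliceNormSq v 2 = 1 := by
  rw [← hv, Fintype.sum_prod_type_right, Fin.sum_univ_three]
  rfl

/-- The quadratic form of `(id₃ ⊗ Φ_{c,b})(v v†)` in terms of slice overlaps. -/
lemma dotProduct_idTensor_PhiG (b c : ℝ) (v u : Fin 3 × Fin 3 → ℂ) :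
    star u ⬝ᵥ (idTensor (PhiG c b) (vecMulVec v (star v)) *ᵥ u) =
      (((1 / 2) * ((3 - b - c) * (‖sliceOverlap v u 0 0‖ ^ 2 + ‖sliceOverlap v u 1 1‖ ^ 2
          + ‖sliceOverlap v u 2 2‖ ^ 2)
        + c * (‖sliceOverlap v u 1 0‖ ^ 2 + ‖sliceOverlap v u 2 1‖ ^ 2
          + ‖sliceOverlap v u 0 2‖ ^ 2)
        + b * (‖sliceOverlap v u 2 0‖ ^ 2 + ‖sliceOverlap v u 0 1‖ ^ 2
          + ‖sliceOverlap v u 1 2‖ ^ 2)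
        - ‖sliceOverlap v u 0 0 + sliceOverlap v u 1 1 + sliceOverlap v u 2 2‖ ^ 2) : ℝ) : ℂ) := by
  push_cast
  simp only [← Complex.conj_mul']
  simp [sliceOverlap, dotProduct, mulVec, idTensor, PhiG, vecMulVec_apply,
    Fintype.sum_prod_type, Fin.sum_univ_three]
  ring

/-- Each eigenvalue of `(id₃ ⊗ Φ_{c,b})(v v†)` is the value of its quadratic form at a unit vector. -/
lemma exists_eigenvalues_idTensor_PhiG_eq (b c : ℝ) (v : Fin 3 × Fin 3 → ℂ)
    (h : (idTensor (PhiG c b) (vecMulVec v (star v))).IsHermitian) (i : Fin 3 × Fin 3) :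
    ∃ u : Fin 3 × Fin 3 → ℂ, ∑ p, ‖u p‖ ^ 2 = 1 ∧ h.eigenvalues i =
      (1 / 2) * ((3 - b - c) * (‖sliceOverlap v u 0 0‖ ^ 2 + ‖sliceOverlap v u 1 1‖ ^ 2
          + ‖sliceOverlap v u 2 2‖ ^ 2)
        + c * (‖sliceOverlap v u 1 0‖ ^ 2 + ‖sliceOverlap v u 2 1‖ ^ 2
          + ‖sliceOverlap v u 0 2‖ ^ 2)
        + b * (‖sliceOverlap v u 2 0‖ ^ 2 + ‖sliceOverlap v u 0 1‖ ^ 2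
          + ‖sliceOverlap v u 1 2‖ ^ 2)
        - ‖sliceOverlap v u 0 0 + sliceOverlap v u 1 1 + sliceOverlap v u 2 2‖ ^ 2) := by
  refine ⟨h.eigenvectorBasis i, ?_, ?_⟩
  · rw [← EuclideanSpace.norm_sq_eq, h.eigenvectorBasis.orthonormal.1 i, one_pow]
  · rw [h.eigenvalues_eq i, dotProduct_idTensor_PhiG]
    exact Complex.ofReal_re _

/-- Upper bounds on the eigenvalues of `(id₃ ⊗ Φ_{b,c}†)(v v†)` for `b, c ≥ 0` with
`b + c ≥ 2/3`, split into the two cases of Lemma A.1. -/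
theorem eigenvalues_idTensor_PhiGdual_upper_bound (b c : ℝ) (hb : 0 ≤ b) (hc : 0 ≤ c)
    (hbc : 2 / 3 ≤ b + c) (v : Fin 3 × Fin 3 → ℂ)
    (hv : (∑ p, star (v p) * v p) = (1 : ℂ))
    (h : (idTensor (PhiG c b) (Matrix.vecMulVec v (star v))).IsHermitian) :
    ((3 ≤ 2 * b + c ∨ 3 ≤ b + 2 * c) →
        ∀ i, h.eigenvalues i ≤ max b c / 2) ∧
    ((2 * b + c < 3 ∧ b + 2 * c < 3) →
        ∀ i, h.eigenvalues i ≤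
          (b ^ 2 + c ^ 2 - 6 * (b + c) + b * c + 9) / (6 * (2 - b - c))) := by
  have hv' : ∑ p, ‖v p‖ ^ 2 = 1 := by
    have : ((∑ p, ‖v p‖ ^ 2 : ℝ) : ℂ) = 1 := by
      rw [← hv]
      push_cast
      exact Finset.sum_congr rfl fun p _ => (Complex.conj_mul' _).symm
    exact_mod_cast this
  have hP := sliceNormSq_sum v hv'
  have P₀ := sliceNormSq_nonneg v 0
  have P₁ := sliceNormSq_nonneg v 1
  have P₂ := sliceNormSq_nonneg v 2
  refine ⟨fun hcase i => ?_, fun hcase i => ?_⟩ <;>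
    obtain ⟨u, hu, hev⟩ := exists_eigenvalues_idTensor_PhiG_eq b c v h i <;>
    have hQ := sliceNormSq_sum u hu <;>
    have cs := norm_sliceOverlap_sq_le v u <;>
    rw [hev]
  · have hbm : b ≤ max b c := le_max_left b c
    have hcm : c ≤ max b c := le_max_right b c
    generalize max b c = μ at *
    have hAm : 3 - b - c ≤ μ := by rcases hcase with h | h <;> linarith
    have hμ : 0 ≤ μ := hb.trans hbm
    have bound : ∀ x, x ≤ μ → ∀ m k, x * ‖sliceOverlap v u m k‖ ^ 2 ≤
        μ * (sliceNormSq v m * sliceNormSq u k) := fun x hx m k =>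
      mul_le_mul hx (cs m k) (sq_nonneg _) hμ
    have e : μ = μ * ((sliceNormSq v 0 + sliceNormSq v 1 + sliceNormSq v 2) *
        (sliceNormSq u 0 + sliceNormSq u 1 + sliceNormSq u 2)) := by rw [hP, hQ]; ring
    have := bound _ hAm 0 0
    have := bound _ hAm 1 1
    have := bound _ hAm 2 2
    have := bound _ hcm 1 0
    have := bound _ hcm 2 1
    have := bound _ hcm 0 2
    have := bound _ hbm 2 0
    have := bound _ hbm 0 1
    have := bound _ hbm 1 2
    have := sq_nonneg ‖sliceOverlap v u 0 0 + sliceOverlap v u 1 1 + sliceOverlap v u 2 2‖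
    linarith
  · obtain ⟨h₁, h₂⟩ := hcase
    have ha : 0 < 2 - b - c := by linarith
    obtain ⟨μ, hμ⟩ : ∃ μ, μ = (b ^ 2 + c ^ 2 - 6 * (b + c) + b * c + 9) / (3 * (2 - b - c)) :=
      ⟨_, rfl⟩
    have hμ2 : (b ^ 2 + c ^ 2 - 6 * (b + c) + b * c + 9) / (6 * (2 - b - c)) = μ / 2 := by
      rw [hμ]; field_simp; ring
    have eA : 3 - b - c - μ = (3 - 2 * b - c) * (3 - b - 2 * c) / (3 * (2 - b - c)) := by
      rw [hμ]; field_simp; ring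
    have ec : μ - c = (3 - b - 2 * c) ^ 2 / (3 * (2 - b - c)) := by
      rw [hμ]; field_simp; ring
    have eb : μ - b = (3 - 2 * b - c) ^ 2 / (3 * (2 - b - c)) := by
      rw [hμ]; field_simp; ring
    have q₁ : 0 < 3 - 2 * b - c := by linarith
    have q₂ : 0 < 3 - b - 2 * c := by linarith
    have hA : 0 < 3 - b - c - μ := by rw [eA]; positivity
    have hc' : 0 < μ - c := by rw [ec]; positivity
    have hb' : 0 < μ - b := by rw [eb]; positivity
    have hA1 : 3 - b - c - μ ≤ 1 := by
      rw [eA, div_le_one (by positivity)]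
      nlinarith [sq_nonneg (b - c), mul_nonneg (sub_nonneg.2 hbc) ha.le]
    have main := choi_scalar_bound (3 - b - c) b c μ _ _ _ _ _ _ _ _ _ (by linarith) hA1 hc
      (by linarith) (by linarith) (by rw [eA, eb, ec]; ring) P₀ P₁ P₂ (sliceNormSq_nonneg u 0)
      (sliceNormSq_nonneg u 1) (sliceNormSq_nonneg u 2) (cs 0 0) (cs 1 1) (cs 2 2)
    rw [hP, hQ] at main
    rw [hμ2]
    have := mul_le_mul_of_nonneg_left (cs 1 0) hc
    have := mul_le_mul_of_nonneg_left (cs 2 1) hc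
    have := mul_le_mul_of_nonneg_left (cs 0 2) hc
    have := mul_le_mul_of_nonneg_left (cs 2 0) hb
    have := mul_le_mul_of_nonneg_left (cs 0 1) hb
    have := mul_le_mul_of_nonneg_left (cs 1 2) hb
    linarith

end
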